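/- If ξ, η, ζ, ω ∈ ℤ² all lie on the circle of radius √n (i.e., ‖ξ‖² = ‖η‖² = ‖ζ‖² = ‖ω‖² = n) and ξ + η + ζ + ω = 0, then the four points cancel in pairs: {ξ, η, ζ, ω} can be arranged so that two of them are the negatives of the other two (i.e., up to permutation, η = −ξ and ω = −ζ). -/

import Mathlib

/-- Among three pairwise orthogonal vectors in the plane, one vanishes. -/
lemma orth_three (a b c d e f : ℤ) (h1 : a * c + b * d = 0) (h2 : a * e + b * f = 0)
    (h3 : c * e + d * f = 0) : (a = 0 ∧ b = 0) ∨ (c = 0 ∧ d = 0) ∨ (e = 0 ∧ f = 0) := by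
  have z : ∀ x y : ℤ, x ^ 2 + y ^ 2 = 0 → x = 0 ∧ y = 0 := fun x y h =>
    ⟨by nlinarith [sq_nonneg x, sq_nonneg y], by nlinarith [sq_nonneg x, sq_nonneg y]⟩
  have ha : a * (c * f - d * e) = 0 := by linear_combination f * h1 - d * h2
  have hb : b * (c * f - d * e) = 0 := by linear_combination c * h2 - e * h1
  by_cases hx : c * f - d * e = 0
  · have : (c ^ 2 + d ^ 2) * (e ^ 2 + f ^ 2) = 0 := by
      linear_combination (c * e + d * f) * h3 + (c * f - d * e) * hx
    rcases mul_eq_zero.1 this with h | h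
    · exact Or.inr (Or.inl (z _ _ h))
    · exact Or.inr (Or.inr (z _ _ h))
  · exact Or.inl ⟨(mul_eq_zero.1 ha).resolve_right hx, (mul_eq_zero.1 hb).resolve_right hx⟩


/-- Zygmund's trick / spectral correlations: if four lattice
points on the circle of radius `√n` sum to zero, then they cancel in pairs. -/
theorem four_lattice_points_on_circle_cancel_in_pairs
    (n : ℕ) (ξ η ζ ω : ℤ × ℤ)
    (hξ : ξ.1 ^ 2 + ξ.2 ^ 2 = (n : ℤ))
    (hη : η.1 ^ 2 + η.2 ^ 2 = (n : ℤ))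
    (hζ : ζ.1 ^ 2 + ζ.2 ^ 2 = (n : ℤ))
    (hω : ω.1 ^ 2 + ω.2 ^ 2 = (n : ℤ))
    (hsum : ξ + η + ζ + ω = 0) :
    (η = -ξ ∧ ω = -ζ) ∨ (ζ = -ξ ∧ ω = -η) ∨ (ω = -ξ ∧ ζ = -η) := by

  obtain ⟨a, b⟩ := ξ
  obtain ⟨c, d⟩ := η
  obtain ⟨e, f⟩ := ζ
  obtain ⟨g, h⟩ := ω
  simp only [Prod.mk_add_mk, Prod.mk_eq_zero, Prod.neg_mk, Prod.mk.injEq] at *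
  obtain ⟨s1, s2⟩ := hsum
  obtain rfl : g = -a - c - e := by linarith
  obtain rfl : h = -b - d - f := by linarith
  have key := orth_three (a + c) (b + d) (a + e) (b + f) (c + e) (d + f)
    (by linarith) (by linarith) (by linarith)
  omega
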